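/- For every τ > 0, the set Z(τ) := {nonempty words a : |I_a| ≤ τ < |I_{a'}|} (with the convention |I_∅| := +∞ for the empty word) is a finite set, and there exists N ∈ ℕ such that every word of length at least N has exactly one prefix belonging to Z(τ); that is, Z(τ) is a partition. -/

import Mathlib

open Complex MeasureTheory Metric Set
open scoped Real

noncomputable section


abbrev SL2R := Matrix.SpecialLinearGroup (Fin 2) ℝ

/-- Entries of a matrix in `SL(2,ℝ)`, as complex numbers. -/
def mA (g : SL2R) : ℂ := ((g.1 0 0 : ℝ) : ℂ)
def mB (g : SL2R) : ℂ := ((g.1 0 1 : ℝ) : ℂ)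
def mC (g : SL2R) : ℂ := ((g.1 1 0 : ℝ) : ℂ)
def mD (g : SL2R) : ℂ := ((g.1 1 1 : ℝ) : ℂ)

/-- The Möbius action of `SL(2,ℝ)` on the Riemann sphere `ℂ ∪ {∞}`. -/
def moebius (g : SL2R) : OnePoint ℂ → OnePoint ℂ := fun z =>
  match z with
  | OnePoint.infty => if mC g = 0 then OnePoint.infty else ((mA g / mC g : ℂ) : OnePoint ℂ)
  | (w : ℂ) => if mC g * w + mD g = 0 then OnePoint.infty
      else (((mA g * w + mB g) / (mC g * w + mD g) : ℂ) : OnePoint ℂ)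

/-- The Möbius action on `ℂ`, with junk value at the pole. -/
def moebiusC (g : SL2R) (z : ℂ) : ℂ := (mA g * z + mB g) / (mC g * z + mD g)

/-- The Möbius action on `ℝ`, with junk value at the pole. -/
def moebiusR (g : SL2R) (x : ℝ) : ℝ :=
  (g.1 0 0 * x + g.1 0 1) / (g.1 1 0 * x + g.1 1 1)

/-- The complex derivative `γ'(z) = (cz+d)⁻²` of a Möbius transformation (`det = 1`). -/
def dMob (g : SL2R) (z : ℂ) : ℂ := ((mC g * z + mD g)⁻¹) ^ 2

/-- The involution `a ↦ ā` on the alphabet `{1, …, 2r}` (as `Fin (2*r)`). -/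
def bar {r : ℕ} (a : Fin (2 * r)) : Fin (2 * r) :=
  if h : (a : ℕ) < r then ⟨(a : ℕ) + r, by omega⟩
  else ⟨(a : ℕ) - r, by have := a.isLt; omega⟩

/-- Schottky data: `2r` pairwise disjoint closed disks centered on the real axis and
`2r` elements of `SL(2,ℝ)` with `γ_a((ℂ∪{∞}) \ interior D_{ā}) = D_a`, `γ_ā = γ_a⁻¹`. -/
structure Schottky (r : ℕ) where
  hr : 1 ≤ r
  center : Fin (2 * r) → ℝ
  radius : Fin (2 * r) → ℝ
  radius_pos : ∀ a, 0 < radius a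
  disj : Pairwise fun a b =>
    Disjoint (closedBall ((center a : ℝ) : ℂ) (radius a)) (closedBall ((center b : ℝ) : ℂ) (radius b))
  γ : Fin (2 * r) → SL2R
  γ_bar : ∀ a, γ (bar a) = (γ a)⁻¹
  γ_maps : ∀ a, moebius (γ a) ''
      (univ \ ((fun z : ℂ => (z : OnePoint ℂ)) '' interior (closedBall ((center (bar a) : ℝ) : ℂ) (radius (bar a)))))
    = (fun z : ℂ => (z : OnePoint ℂ)) '' closedBall ((center a : ℝ) : ℂ) (radius a)

/-- Words: finite sequences of letters with `a_{j+1} ≠ ā_j`. -/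
def IsWord {r : ℕ} (w : List (Fin (2 * r))) : Prop := w.Chain' fun x y => y ≠ bar x

/-- The word `ā := ā_n ⋯ ā_1`. -/
def barWord {r : ℕ} (w : List (Fin (2 * r))) : List (Fin (2 * r)) := (w.map bar).reverse

namespace Schottky

variable {r : ℕ} (S : Schottky r)

/-- The disk `D_a` for a letter `a`. -/
def disk (a : Fin (2 * r)) : Set ℂ := closedBall ((S.center a : ℝ) : ℂ) (S.radius a)

/-- `γ_w := γ_{a_1} ⋯ γ_{a_n}`. -/
def g (w : List (Fin (2 * r))) : SL2R := (w.map S.γ).prod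

/-- The disk `D_w := γ_{w'}(D_{a_n})` of a nonempty word, as a subset of the Riemann sphere. -/
def sdisk : List (Fin (2 * r)) → Set (OnePoint ℂ)
  | [] => ∅
  | a :: w => moebius (S.g ((a :: w).dropLast)) ''
      ((fun z : ℂ => (z : OnePoint ℂ)) '' S.disk ((a :: w).getLast (List.cons_ne_nil a w)))

/-- The disk `D_w` as a subset of `ℂ`. -/
def wdisk (w : List (Fin (2 * r))) : Set ℂ := {z : ℂ | (z : OnePoint ℂ) ∈ S.sdisk w}

/-- The interval `I_w = D_w ∩ ℝ`, as a subset of `ℝ`. -/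
def wint (w : List (Fin (2 * r))) : Set ℝ := {x : ℝ | ((x : ℝ) : ℂ) ∈ S.wdisk w}

/-- The length `|I_w|` of the interval `I_w`. -/
def wlen (w : List (Fin (2 * r))) : ℝ := Metric.diam (S.wint w)

/-- `D = ⋃_{a ∈ A} D_a`. -/
def D : Set ℂ := ⋃ a, S.disk a

/-- `I = D ∩ ℝ`, as a subset of `ℝ`. -/
def Ire : Set ℝ := {x : ℝ | ((x : ℝ) : ℂ) ∈ S.D}

/-- `D₂ = ⋃_{|w| = 2} D_w`. -/
def D₂ : Set ℂ := ⋃ (a : Fin (2 * r)), ⋃ (b : Fin (2 * r)), ⋃ (_ : b ≠ bar a), S.wdisk [a, b]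

/-- `I'_a` for a letter `a`: the convex hull of `⋃_{b ≠ ā} I_{ab}`. -/
def iprimeLetter (a : Fin (2 * r)) : Set ℝ :=
  convexHull ℝ (⋃ (b : Fin (2 * r)), ⋃ (_ : b ≠ bar a), S.wint [a, b])

/-- `I'_w := γ_{w'}(I'_{a_n})` for a nonempty word `w`. -/
def iprime : List (Fin (2 * r)) → Set ℝ
  | [] => ∅
  | a :: w => moebiusR (S.g ((a :: w).dropLast)) ''
      S.iprimeLetter ((a :: w).getLast (List.cons_ne_nil a w))

/-- The partition `Z(τ)`. -/
def Ztau (τ : ℝ) : Set (List (Fin (2 * r))) :=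
  {w | w ≠ [] ∧ IsWord w ∧ S.wlen w ≤ τ ∧ (w.dropLast = [] ∨ τ < S.wlen w.dropLast)}

/-- The limit set `Λ_Γ ⊂ ℝ`. -/
def limitSet : Set ℝ :=
  {x : ℝ | ∀ n : ℕ, 1 ≤ n → ∃ w : List (Fin (2 * r)), IsWord w ∧ w.length = n ∧ x ∈ S.wint w}

/-- The τ-neighbourhood `Λ_Γ(τ) ⊂ ℝ` of the limit set. -/
def limitSetNbhd (τ : ℝ) : Set ℝ := {x : ℝ | ∃ y ∈ S.limitSet, |x - y| ≤ τ}

end Schottky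

/-- `ℓ` is a holomorphic branch on `U` of the logarithm of the derivative of the Möbius
transformation of `g`, real on `U ∩ ℝ`. -/
structure IsLogBranch (g : SL2R) (U : Set ℂ) (ℓ : ℂ → ℂ) : Prop where
  holo : DifferentiableOn ℂ ℓ U
  exp_eq : ∀ z ∈ U, Complex.exp (ℓ z) = dMob g z
  real_on : ∀ x : ℝ, ((x : ℝ) : ℂ) ∈ U → (ℓ ((x : ℝ) : ℂ)).im = 0

/-- A family of branches `ℓ a b` of `log γ_a'` on `D_b`, for all `a ≠ b̄`. -/
def IsBranchFamily {r : ℕ} (S : Schottky r) (ℓ : Fin (2 * r) → Fin (2 * r) → ℂ → ℂ) : Prop :=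
  ∀ a b : Fin (2 * r), a ≠ bar b → IsLogBranch (S.γ a) (S.disk b) (ℓ a b)

/-- The fixed-point equation `L_s u = u` on the interior of `D`, written pointwise. -/
def TransferFixed {r : ℕ} (S : Schottky r) (s : ℂ)
    (ℓ : Fin (2 * r) → Fin (2 * r) → ℂ → ℂ) (u : ℂ → ℂ) : Prop :=
  ∀ b : Fin (2 * r), ∀ z ∈ interior (S.disk b),
    u z = ∑ a : Fin (2 * r), if a ≠ bar b then
      Complex.exp (s * ℓ a b z) * u (moebiusC (S.γ a) z) else 0

/-- The transfer operator `L_s`, as an operator on functions. -/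
def transferOp {r : ℕ} (S : Schottky r) (s : ℂ)
    (ℓ : Fin (2 * r) → Fin (2 * r) → ℂ → ℂ) (u : ℂ → ℂ) : ℂ → ℂ := fun z =>
  ∑ b : Fin (2 * r), (S.disk b).indicator
    (fun w => ∑ a : Fin (2 * r), if a ≠ bar b then
      Complex.exp (s * ℓ a b w) * u (moebiusC (S.γ a) w) else 0) z

/-- A partition: a finite set of nonempty words such that every long enough word
has exactly one prefix in it. -/
def IsPartition {r : ℕ} (S : Schottky r) (Z : Finset (List (Fin (2 * r)))) : Prop :=
  (∀ w ∈ Z, w ≠ [] ∧ IsWord w) ∧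
  ∃ N : ℕ, ∀ w : List (Fin (2 * r)), IsWord w → N ≤ w.length →
    ∃! p : List (Fin (2 * r)), p ∈ Z ∧ p <+: w


/-- The denominator `cx + d` of a real Möbius transformation. -/
def den (g : SL2R) (x : ℝ) : ℝ := g.1 1 0 * x + g.1 1 1

lemma sl2_det (g : SL2R) : g.1 0 0 * g.1 1 1 - g.1 0 1 * g.1 1 0 = 1 := by
  rw [← Matrix.det_fin_two]; exact g.2

lemma moebius_mul (g h : SL2R) (z : OnePoint ℂ) :
    moebius (g * h) z = moebius g (moebius h z) := by
  classical
  have key : ∀ (g : SL2R) (z : OnePoint ℂ), moebius g z =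
      ((Matrix.SpecialLinearGroup.map Complex.ofRealHom g :
        Matrix.SpecialLinearGroup (Fin 2) ℂ) : GL (Fin 2) ℂ) • z := by
    intro g z
    induction z using OnePoint.rec with
    | infty =>
      rw [OnePoint.smul_infty_eq_ite]
      rfl
    | coe z =>
      rw [OnePoint.smul_some_eq_ite]
      rfl
  rw [key, key, key, map_mul, map_mul, mul_smul]

lemma moebius_one (z : OnePoint ℂ) : moebius 1 z = z := by
  induction z using OnePoint.rec with
  | infty => simp [moebius, mC]
  | coe z => simp [moebius, mA, mB, mC, mD]

lemma moebius_ofReal {g : SL2R} {x : ℝ} (h : den g x ≠ 0) :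
    moebius g ((x : ℂ) : OnePoint ℂ) = ((moebiusR g x : ℝ) : ℂ) := by
  have h' : mC g * x + mD g ≠ 0 := by
    simpa [mC, mD, den] using (Complex.ofReal_ne_zero.2 h)
  simp only [moebius, if_neg h']
  simp [moebiusR, mA, mB, mC, mD]

lemma den_ne_zero_of_moebius_eq_coe {g : SL2R} {x : ℝ} {y : ℂ}
    (h : moebius g ((x : ℂ) : OnePoint ℂ) = y) : den g x ≠ 0 := by
  intro h0
  have h' : mC g * x + mD g = 0 := by
    simpa [mC, mD, den] using congrArg ((↑) : ℝ → ℂ) h0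
  simp [moebius, h'] at h

lemma exists_ofReal_of_moebius_eq_ofReal {g : SL2R} {z : ℂ} {x : ℝ}
    (h : moebius g (z : OnePoint ℂ) = ((x : ℝ) : ℂ)) : ∃ t : ℝ, z = t := by
  by_cases h0 : mC g * z + mD g = 0
  · simp [moebius, h0] at h
  · simp only [moebius, if_neg h0, OnePoint.coe_eq_coe, div_eq_iff h0] at h
    have hd : mA g * mD g - mB g * mC g = 1 := by
      have := congrArg ((↑) : ℝ → ℂ) (sl2_det g)
      simpa [mA, mB, mC, mD] using this
    have h1 : mA g - x * mC g ≠ 0 := by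
      intro h1
      have h2 : mB g = x * mD g := by linear_combination h - z * h1
      have : (1 : ℂ) = 0 := by linear_combination -hd + mD g * h1 - mC g * h2
      exact one_ne_zero this
    refine ⟨(x * g.1 1 1 - g.1 0 1) / (g.1 0 0 - x * g.1 1 0), ?_⟩
    have : z = (x * mD g - mB g) / (mA g - x * mC g) := by
      rw [eq_div_iff h1]; linear_combination h
    rw [this]; simp [mA, mB, mC, mD]

lemma moebiusR_sub {g : SL2R} {x y : ℝ} (hx : den g x ≠ 0) (hy : den g y ≠ 0) :
    moebiusR g y - moebiusR g x = (y - x) / (den g x * den g y) := by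
  have hd := sl2_det g
  have e : ∀ t, moebiusR g t = (g.1 0 0 * t + g.1 0 1) / den g t := fun _ => rfl
  rw [e, e, div_sub_div _ _ hy hx, div_eq_div_iff (mul_ne_zero hy hx) (mul_ne_zero hx hy)]
  unfold den
  linear_combination (y - x) * (g.1 1 0 * y + g.1 1 1) * (g.1 1 0 * x + g.1 1 1) * hd

lemma den_mul_pos {g : SL2R} {p q : ℝ} (h : ∀ x ∈ Icc p q, den g x ≠ 0)
    {x y : ℝ} (hx : x ∈ Icc p q) (hy : y ∈ Icc p q) : 0 < den g x * den g y := by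
  by_contra! hneg
  have hc : ContinuousOn (den g) (Icc p q) := by unfold den; fun_prop
  have hI := isPreconnected_Icc.image _ hc
  have hmem : (0 : ℝ) ∈ den g '' Icc p q := by
    rcases mul_nonpos_iff.1 hneg with ⟨h1, h2⟩ | ⟨h1, h2⟩
    · exact hI.ordConnected.out (mem_image_of_mem _ hy) (mem_image_of_mem _ hx) ⟨h2, h1⟩
    · exact hI.ordConnected.out (mem_image_of_mem _ hx) (mem_image_of_mem _ hy) ⟨h1, h2⟩
  obtain ⟨t, ht, h0⟩ := hmem
  exact h t ht h0

lemma moebiusR_monotoneOn {g : SL2R} {p q : ℝ} (h : ∀ x ∈ Icc p q, den g x ≠ 0) :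
    MonotoneOn (moebiusR g) (Icc p q) := by
  intro x hx y hy hxy
  have := moebiusR_sub (h x hx) (h y hy)
  have h2 : 0 ≤ (y - x) / (den g x * den g y) :=
    div_nonneg (sub_nonneg.2 hxy) (den_mul_pos h hx hy).le
  linarith

/-- A Möbius transformation with controlled distortion on `[p, q]` shortens subsets of
`[p + δ, q]` by a definite factor. -/
lemma diam_moebiusR_image_le {g : SL2R} {p q δ M : ℝ} (hδ : 0 < δ) (hM : 0 < M) (hpq : p < q)
    (h : ∀ x ∈ Icc p q, den g x ≠ 0)
    (hd : ∀ x ∈ Icc p q, ∀ y ∈ Icc p q, |den g x| ≤ M * |den g y|)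
    {K : Set ℝ} (hne : K.Nonempty) (hK : K ⊆ Icc (p + δ) q) :
    diam (moebiusR g '' K) ≤ (1 - δ / ((q - p) * M)) * diam (moebiusR g '' Icc p q) := by
  have hs : p + δ ≤ q := let ⟨x, hx⟩ := hne; (hK hx).1.trans (hK hx).2
  have mp : p ∈ Icc p q := ⟨le_rfl, hpq.le⟩
  have mq : q ∈ Icc p q := ⟨hpq.le, le_rfl⟩
  have ms : p + δ ∈ Icc p q := ⟨by linarith, hs⟩
  have mono := moebiusR_monotoneOn h
  have sub1 : moebiusR g '' Icc p q ⊆ Icc (moebiusR g p) (moebiusR g q) := by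
    rintro _ ⟨x, hx, rfl⟩
    exact ⟨mono mp hx hx.1, mono hx mq hx.2⟩
  have sub2 : moebiusR g '' K ⊆ Icc (moebiusR g (p + δ)) (moebiusR g q) := by
    rintro _ ⟨x, hx, rfl⟩
    have hx' : x ∈ Icc p q := ⟨by linarith [(hK hx).1], (hK hx).2⟩
    exact ⟨mono ms hx' (hK hx).1, mono hx' mq hx'.2⟩
  have e1 : diam (moebiusR g '' Icc p q) = moebiusR g q - moebiusR g p := by
    apply le_antisymm
    · rw [← Real.diam_Icc (mono mp mq hpq.le)]
      exact diam_mono sub1 (Metric.isBounded_Icc _ _)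
    · have := dist_le_diam_of_mem ((Metric.isBounded_Icc _ _).subset sub1)
        (mem_image_of_mem _ mq) (mem_image_of_mem _ mp)
      rw [Real.dist_eq] at this
      exact (le_abs_self _).trans this
  have e2 : diam (moebiusR g '' K) ≤ moebiusR g q - moebiusR g (p + δ) := by
    rw [← Real.diam_Icc (mono ms mq hs)]
    exact diam_mono sub2 (Metric.isBounded_Icc _ _)
  have e3 : δ / ((q - p) * M) * (moebiusR g q - moebiusR g p) ≤
      moebiusR g (p + δ) - moebiusR g p := by
    rw [moebiusR_sub (h p mp) (h q mq), moebiusR_sub (h p mp) (h _ ms)]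
    have p1 := den_mul_pos h mp mq
    have p2 := den_mul_pos h mp ms
    have hle : den g p * den g (p + δ) ≤ M * (den g p * den g q) := by
      have := mul_le_mul_of_nonneg_left (hd _ ms _ mq) (abs_nonneg (den g p))
      rw [← abs_mul, mul_left_comm, ← abs_mul, abs_of_pos p1, abs_of_pos p2] at this
      exact this
    have hqp : q - p ≠ 0 := by linarith
    calc δ / ((q - p) * M) * ((q - p) / (den g p * den g q))
        = δ / (M * (den g p * den g q)) := by
          have := p1.ne'
          field_simp
      _ ≤ δ / (den g p * den g (p + δ)) := div_le_div_of_nonneg_left hδ.le p2 hle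
      _ = _ := by ring
  rw [e1]
  linarith

lemma bar_bar {r : ℕ} (a : Fin (2 * r)) : bar (bar a) = a := by
  have := a.isLt
  unfold bar
  split_ifs with h1 h2 h2 <;> simp only [Fin.ext_iff] at h2 ⊢ <;> omega

namespace Schottky

variable {r : ℕ} (S : Schottky r)

/-- The interval `I_a` for a letter `a`, by its endpoints. -/
def interval (a : Fin (2 * r)) : Set ℝ :=
  Icc (S.center a - S.radius a) (S.center a + S.radius a)

lemma ofReal_mem_disk {a : Fin (2 * r)} {x : ℝ} : (x : ℂ) ∈ S.disk a ↔ x ∈ S.interval a := by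
  rw [disk, interval, mem_closedBall, Complex.dist_of_im_eq (by simp)]
  simp only [Complex.ofReal_re]
  rw [← Real.closedBall_eq_Icc, mem_closedBall]

lemma disk_disjoint {a b : Fin (2 * r)} (h : a ≠ b) : Disjoint (S.disk a) (S.disk b) :=
  S.disj h

lemma g_cons (a : Fin (2 * r)) (w : List (Fin (2 * r))) : S.g (a :: w) = S.γ a * S.g w := by
  simp [g]

lemma g_append_singleton (w : List (Fin (2 * r))) (a : Fin (2 * r)) :
    S.g (w ++ [a]) = S.g w * S.γ a := by
  simp [g]

lemma g_nil : S.g [] = 1 := by simp [g]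

/-- A generator `γ_a` maps every point outside the interior of `D_ā` into `D_a`. -/
lemma moebius_γ_mem {a : Fin (2 * r)} {z : OnePoint ℂ}
    (hz : z ∉ (fun z : ℂ => (z : OnePoint ℂ)) '' interior (S.disk (bar a))) :
    ∃ y ∈ S.disk a, moebius (S.γ a) z = (y : OnePoint ℂ) := by
  have : moebius (S.γ a) z ∈ (fun z : ℂ => (z : OnePoint ℂ)) '' S.disk a := by
    rw [disk, ← S.γ_maps a]
    exact mem_image_of_mem _ ⟨mem_univ _, hz⟩
  obtain ⟨y, hy, e⟩ := this
  exact ⟨y, hy, e.symm⟩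

lemma coe_notMem_of_notMem {s : Set ℂ} {z : ℂ} (hz : z ∉ s) :
    (z : OnePoint ℂ) ∉ (fun z : ℂ => (z : OnePoint ℂ)) '' interior s := by
  rintro ⟨y, hy, e⟩
  rw [OnePoint.coe_eq_coe] at e
  exact hz (e ▸ interior_subset hy)

/-- For a nonempty word `w`, `γ_w` maps every point outside the interior of the disk of the
inverse of the last letter into the disk of the first letter. -/
lemma moebius_g_mem (u : List (Fin (2 * r))) (a : Fin (2 * r)) (hw : IsWord (u ++ [a]))
    {z : OnePoint ℂ}
    (hz : z ∉ (fun z : ℂ => (z : OnePoint ℂ)) '' interior (S.disk (bar a)))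
    (e : Fin (2 * r)) (he : e ∈ (u ++ [a]).head?) :
    ∃ y ∈ S.disk e, moebius (S.g (u ++ [a])) z = (y : OnePoint ℂ) := by
  induction u generalizing e with
  | nil =>
    simp only [List.nil_append, List.head?_cons, Option.mem_def, Option.some.injEq] at he
    subst he
    rw [List.nil_append, g_cons, g_nil, mul_one]
    exact S.moebius_γ_mem hz
  | cons c u ih =>
    have he : c = e := by simpa using he
    subst he
    obtain ⟨h1, h2⟩ := List.isChain_cons.1 hw
    obtain ⟨f, hf⟩ : ∃ f, f ∈ (u ++ [a]).head? := by cases u <;> simp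
    obtain ⟨y, hy, hyz⟩ := ih h2 f hf
    rw [List.cons_append, g_cons, moebius_mul, hyz]
    exact S.moebius_γ_mem (coe_notMem_of_notMem
      ((S.disk_disjoint (h1 f hf)).notMem_of_mem_left hy))

lemma moebius_g_disk {u : List (Fin (2 * r))} {a : Fin (2 * r)} (hw : IsWord (u ++ [a]))
    {z : ℂ} (hz : z ∈ S.disk a) : ∃ y : ℂ, moebius (S.g u) z = (y : OnePoint ℂ) := by
  rcases List.eq_nil_or_concat u with rfl | ⟨v, c, rfl⟩
  · exact ⟨z, by rw [g_nil, moebius_one]⟩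
  · rw [List.concat_eq_append] at hw ⊢
    obtain ⟨h1, -, h3⟩ := List.isChain_append.1 hw
    have hac : a ≠ bar c := h3 c (by simp) a (by simp)
    obtain ⟨f, hf⟩ : ∃ f, f ∈ (v ++ [c]).head? := by cases v <;> simp
    obtain ⟨y, -, e⟩ := S.moebius_g_mem v c h1
      (coe_notMem_of_notMem ((S.disk_disjoint hac).notMem_of_mem_left hz)) f hf
    exact ⟨y, e⟩

lemma den_g_ne_zero {u : List (Fin (2 * r))} {a : Fin (2 * r)} (hw : IsWord (u ++ [a]))
    {x : ℝ} (hx : x ∈ S.interval a) : den (S.g u) x ≠ 0 := by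
  obtain ⟨y, hy⟩ := S.moebius_g_disk hw (S.ofReal_mem_disk.2 hx)
  exact den_ne_zero_of_moebius_eq_coe hy

lemma sdisk_append_singleton (u : List (Fin (2 * r))) (a : Fin (2 * r)) :
    S.sdisk (u ++ [a]) = moebius (S.g u) '' ((fun z : ℂ => (z : OnePoint ℂ)) '' S.disk a) := by
  obtain ⟨b, w, h⟩ : ∃ b w, u ++ [a] = b :: w := List.exists_cons_of_ne_nil (by simp)
  have h1 : (b :: w).dropLast = u := by rw [← h]; simp
  have h2 : (b :: w).getLast (List.cons_ne_nil b w) = a := by simp [← h]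
  rw [h, sdisk, h1, h2]

lemma wint_append_singleton {u : List (Fin (2 * r))} {a : Fin (2 * r)} (hw : IsWord (u ++ [a])) :
    S.wint (u ++ [a]) = moebiusR (S.g u) '' S.interval a := by
  ext x
  simp only [wint, wdisk, sdisk_append_singleton, mem_ofPred_eq, mem_image,
    exists_exists_and_eq_and]
  constructor
  · rintro ⟨z, hz, e⟩
    obtain ⟨t, rfl⟩ := exists_ofReal_of_moebius_eq_ofReal e
    rw [S.ofReal_mem_disk] at hz
    rw [moebius_ofReal (S.den_g_ne_zero hw hz), OnePoint.coe_eq_coe, Complex.ofReal_inj] at e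
    exact ⟨t, hz, e⟩
  · rintro ⟨t, ht, rfl⟩
    exact ⟨t, S.ofReal_mem_disk.2 ht, moebius_ofReal (S.den_g_ne_zero hw ht)⟩

lemma wint_append_pair {u : List (Fin (2 * r))} {a b : Fin (2 * r)}
    (hw : IsWord (u ++ [a] ++ [b])) :
    S.wint (u ++ [a] ++ [b]) = moebiusR (S.g u) '' S.wint [a, b] := by
  obtain ⟨h1, -, h3⟩ := List.isChain_append.1 hw
  have hba : b ≠ bar a := h3 a (by simp) b (by simp)
  have hab : IsWord ([a] ++ [b]) := List.isChain_pair.2 hba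
  have hab' : S.wint [a, b] = moebiusR (S.γ a) '' S.interval b := by
    have := S.wint_append_singleton hab
    rwa [show S.g [a] = S.γ a by rw [g_cons, g_nil, mul_one]] at this
  rw [hab', S.wint_append_singleton hw, image_image]
  refine image_congr fun x hx => ?_
  have d1 := S.den_g_ne_zero hw hx
  have d2 : den (S.γ a) x ≠ 0 := by
    have := S.den_g_ne_zero hab hx
    rwa [show S.g [a] = S.γ a by rw [g_cons, g_nil, mul_one]] at this
  have e := moebius_ofReal d1
  rw [g_append_singleton, moebius_mul, moebius_ofReal d2] at e
  rw [moebius_ofReal (den_ne_zero_of_moebius_eq_coe e), OnePoint.coe_eq_coe,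
    Complex.ofReal_inj, ← g_append_singleton] at e
  exact e.symm

/-- `I_{ab}` stays at a positive distance from the left endpoint of `I_a`. -/
lemma exists_wint_pair_subset {a b : Fin (2 * r)} (hba : b ≠ bar a) :
    ∃ δ > 0, S.wint [a, b] ⊆
      Icc (S.center a - S.radius a + δ) (S.center a + S.radius a) := by
  have hab : IsWord ([a] ++ [b]) := List.isChain_pair.2 hba
  have hga : S.g [a] = S.γ a := by rw [g_cons, g_nil, mul_one]
  have himg : S.wint [a, b] = moebiusR (S.γ a) '' S.interval b := by
    rw [← hga]; exact S.wint_append_singleton hab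
  have hden : ∀ x ∈ S.interval b, den (S.γ a) x ≠ 0 := fun x hx => by
    rw [← hga]; exact S.den_g_ne_zero hab hx
  have hsub : S.wint [a, b] ⊆ S.interval a := by
    rw [himg]
    rintro _ ⟨x, hx, rfl⟩
    obtain ⟨y, hy, e⟩ := S.moebius_γ_mem (a := a) (coe_notMem_of_notMem
      ((S.disk_disjoint hba).notMem_of_mem_left (S.ofReal_mem_disk.2 hx)))
    rw [moebius_ofReal (hden x hx), OnePoint.coe_eq_coe] at e
    rw [← S.ofReal_mem_disk, e]
    exact hy
  have hcompact : IsCompact (S.wint [a, b]) := by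
    rw [himg]
    refine isCompact_Icc.image_of_continuousOn ?_
    exact ContinuousOn.div (by fun_prop) (by fun_prop) hden
  have hp : S.center a - S.radius a ∉ S.wint [a, b] := by
    rw [himg]
    rintro ⟨x, hx, e⟩
    have e' := moebius_ofReal (hden x hx)
    rw [e] at e'
    have hint : (((S.center a - S.radius a : ℝ) : ℂ) : OnePoint ℂ) ∉
        (fun z : ℂ => (z : OnePoint ℂ)) '' interior (S.disk (bar (bar a))) := by
      rw [bar_bar, disk, interior_closedBall _ (S.radius_pos a).ne']
      rintro ⟨y, hy, ey⟩
      simp only [OnePoint.coe_eq_coe] at ey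
      rw [ey, mem_ball, Complex.dist_of_im_eq (by simp)] at hy
      simp [abs_of_pos (S.radius_pos a)] at hy
    obtain ⟨y, hy, ey⟩ := S.moebius_γ_mem hint
    rw [← e', ← moebius_mul, S.γ_bar, inv_mul_cancel, moebius_one, OnePoint.coe_eq_coe] at ey
    exact (S.disk_disjoint hba).notMem_of_mem_left (S.ofReal_mem_disk.2 hx) (ey ▸ hy)
  obtain ⟨δ, hδ, hball⟩ := Metric.isOpen_iff.1 hcompact.isClosed.isOpen_compl _ hp
  refine ⟨δ, hδ, fun x hx => ⟨?_, (hsub hx).2⟩⟩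
  by_contra! hlt
  refine hball ?_ hx
  rw [mem_ball, Real.dist_eq, abs_of_nonneg (by linarith [(hsub hx).1])]
  linarith

/-- Bounded distortion: the denominators of `γ_u` are uniformly comparable on `I_a`. -/
lemma exists_den_le (c a : Fin (2 * r)) (hac : a ≠ bar c) :
    ∃ M > 0, ∀ v : List (Fin (2 * r)), IsWord (v ++ [c]) →
      ∀ x ∈ S.interval a, ∀ y ∈ S.interval a,
        |den (S.g (v ++ [c])) x| ≤ M * |den (S.g (v ++ [c])) y| := by
  have hdisj : Disjoint (S.interval a) (S.interval (bar c)) := by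
    rw [Set.disjoint_left]
    intro x hx hx'
    exact (S.disk_disjoint hac).notMem_of_mem_left (S.ofReal_mem_disk.2 hx)
      (S.ofReal_mem_disk.2 hx')
  obtain ⟨ε, hε, hsep⟩ := Metric.exists_pos_forall_lt_edist isCompact_Icc isClosed_Icc hdisj
  have hε' : (0 : ℝ) < ε := hε
  have hr := S.radius_pos a
  refine ⟨1 + 2 * S.radius a / ε, by positivity, fun v hv x hx y hy => ?_⟩
  obtain ⟨f, hf⟩ : ∃ f, f ∈ (v ++ [c]).head? := by cases v <;> simp
  set h := S.g (v ++ [c]) with hh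
  have hC : h.1 1 0 ≠ 0 := by
    intro h0
    obtain ⟨z, -, e⟩ := S.moebius_g_mem v c hv (z := OnePoint.infty) (by simp) f hf
    rw [← hh] at e
    simp [moebius, mC, h0] at e
  obtain ⟨t, ht⟩ : ∃ t, t = -h.1 1 1 / h.1 1 0 := ⟨_, rfl⟩
  have hden : ∀ s, den h s = h.1 1 0 * (s - t) := by
    intro s
    rw [ht, den]
    field_simp
    ring
  have htmem : t ∈ S.interval (bar c) := by
    by_contra hnot
    rw [← S.ofReal_mem_disk] at hnot
    obtain ⟨z, -, e⟩ := S.moebius_g_mem v c hv (coe_notMem_of_notMem hnot) f hf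
    exact den_ne_zero_of_moebius_eq_coe e (by rw [← hh, hden]; simp)
  have hyt : (ε : ℝ) ≤ |y - t| := by
    have := hsep y hy t htmem
    rw [edist_nndist, ENNReal.coe_lt_coe] at this
    rw [← Real.dist_eq]
    exact_mod_cast this.le
  have hxy : |x - y| ≤ 2 * S.radius a := by
    rw [abs_le]
    constructor <;> linarith [hx.1, hx.2, hy.1, hy.2]
  rw [hden, hden, abs_mul, abs_mul, mul_left_comm]
  refine mul_le_mul_of_nonneg_left ?_ (abs_nonneg _)
  have h1 : 2 * S.radius a ≤ 2 * S.radius a / ε * |y - t| := by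
    rw [div_mul_eq_mul_div, le_div_iff₀ hε']
    gcongr
  have h2 := abs_sub_le x y t
  linarith

lemma exists_den_le_of_isWord (a : Fin (2 * r)) :
    ∃ M > 0, ∀ u : List (Fin (2 * r)), IsWord (u ++ [a]) →
      ∀ x ∈ S.interval a, ∀ y ∈ S.interval a, |den (S.g u) x| ≤ M * |den (S.g u) y| := by
  have h : ∀ c : Fin (2 * r), ∃ M > 0, a ≠ bar c → ∀ v : List (Fin (2 * r)), IsWord (v ++ [c]) →
      ∀ x ∈ S.interval a, ∀ y ∈ S.interval a,
        |den (S.g (v ++ [c])) x| ≤ M * |den (S.g (v ++ [c])) y| := by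
    intro c
    by_cases hac : a = bar c
    · exact ⟨1, one_pos, fun h => absurd hac h⟩
    · obtain ⟨M, hM, h⟩ := S.exists_den_le c a hac
      exact ⟨M, hM, fun _ => h⟩
  choose M hM h using h
  have hsum : 0 ≤ ∑ c, M c := Finset.sum_nonneg fun c _ => (hM c).le
  refine ⟨1 + ∑ c, M c, by linarith, fun u hu x hx y hy => ?_⟩
  rcases List.eq_nil_or_concat u with rfl | ⟨v, c, rfl⟩
  · simpa [g_nil, den] using hsum
  · rw [List.concat_eq_append] at hu ⊢
    obtain ⟨h1, -, h3⟩ := List.isChain_append.1 hu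
    refine (h c (h3 c (by simp) a (by simp)) v h1 x hx y hy).trans ?_
    refine mul_le_mul_of_nonneg_right ?_ (abs_nonneg _)
    have := Finset.single_le_sum (fun c _ => (hM c).le) (Finset.mem_univ c)
    linarith

lemma exists_wlen_le {a b : Fin (2 * r)} (hba : b ≠ bar a) :
    ∃ κ > 0, ∀ u : List (Fin (2 * r)), IsWord (u ++ [a] ++ [b]) →
      S.wlen (u ++ [a] ++ [b]) ≤ (1 - κ) * S.wlen (u ++ [a]) := by
  obtain ⟨δ, hδ, hsub⟩ := S.exists_wint_pair_subset hba
  obtain ⟨M, hM, hd⟩ := S.exists_den_le_of_isWord a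
  have hr := S.radius_pos a
  refine ⟨δ / ((S.center a + S.radius a - (S.center a - S.radius a)) * M), ?_, fun u hu => ?_⟩
  · rw [show S.center a + S.radius a - (S.center a - S.radius a) = 2 * S.radius a by ring]
    positivity
  have hua : IsWord (u ++ [a]) := (List.isChain_append.1 hu).1
  have hab : IsWord ([a] ++ [b]) := List.isChain_pair.2 hba
  have hne : (S.wint [a, b]).Nonempty := by
    have e : S.wint [a, b] = _ := S.wint_append_singleton hab
    rw [e]
    exact (nonempty_Icc.2 (by linarith [S.radius_pos b])).image _
  rw [wlen, wlen, S.wint_append_pair hu, S.wint_append_singleton hua]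
  exact diam_moebiusR_image_le hδ hM (by linarith) (fun x hx => S.den_g_ne_zero hua hx)
    (hd u hua) hne hsub

/-- The lengths `|I_w|` contract by a uniform factor whenever a letter is appended. -/
lemma exists_uniform_contraction :
    ∃ κ : ℝ, 0 < κ ∧ κ < 1 ∧ ∀ (u : List (Fin (2 * r))) (a b : Fin (2 * r)),
      IsWord (u ++ [a] ++ [b]) → S.wlen (u ++ [a] ++ [b]) ≤ (1 - κ) * S.wlen (u ++ [a]) := by
  have hev : ∀ᶠ κ : ℝ in nhdsWithin 0 (Ioi 0), ∀ a b : Fin (2 * r), ∀ u : List (Fin (2 * r)),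
      IsWord (u ++ [a] ++ [b]) → S.wlen (u ++ [a] ++ [b]) ≤ (1 - κ) * S.wlen (u ++ [a]) := by
    refine Filter.eventually_all.2 fun a => Filter.eventually_all.2 fun b => ?_
    by_cases hba : b = bar a
    · refine Filter.Eventually.of_forall fun κ u hu => ?_
      exact absurd hba ((List.isChain_append.1 hu).2.2 a (by simp) b (by simp))
    · obtain ⟨κ₀, hκ₀, h⟩ := S.exists_wlen_le hba
      filter_upwards [Ioc_mem_nhdsGT hκ₀] with κ hκ u hu
      refine (h u hu).trans (mul_le_mul_of_nonneg_right ?_ diam_nonneg)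
      linarith [hκ.2]
  obtain ⟨κ, h, h0, h1⟩ := (hev.and (Ioo_mem_nhdsGT (one_pos (α := ℝ)))).exists
  exact ⟨κ, h0, h1, fun u a b => h a b u⟩

lemma wlen_le_of_prefix {p w : List (Fin (2 * r))} (hp : p ≠ []) (hpw : p <+: w)
    (hw : IsWord w) : S.wlen w ≤ S.wlen p := by
  obtain ⟨κ, h0, -, h⟩ := S.exists_uniform_contraction
  obtain ⟨s, rfl⟩ := hpw
  induction s using List.reverseRecOn with
  | nil => simp
  | append_singleton s b ih =>
    rw [← List.append_assoc] at hw ⊢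
    refine le_trans ?_ (ih (List.isChain_append.1 hw).1)
    rcases List.eq_nil_or_concat (p ++ s) with e | ⟨v, c, e⟩
    · simp_all
    · rw [List.concat_eq_append] at e
      rw [e] at hw ⊢
      have hd : 0 ≤ S.wlen (v ++ [c]) := diam_nonneg
      have := h v c b hw
      nlinarith

/-- The lengths `|I_w|` tend to zero uniformly as the length of `w` grows. -/
lemma exists_wlen_le_of_length_le {τ : ℝ} (hτ : 0 < τ) :
    ∃ N : ℕ, 1 ≤ N ∧ ∀ w : List (Fin (2 * r)), IsWord w → N ≤ w.length → S.wlen w ≤ τ := by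
  obtain ⟨κ, h0, h1, h⟩ := S.exists_uniform_contraction
  set L : ℝ := ∑ a, S.wlen [a] with hL
  have key : ∀ (u : List (Fin (2 * r))) (b : Fin (2 * r)), IsWord (u ++ [b]) →
      S.wlen (u ++ [b]) ≤ (1 - κ) ^ u.length * L := by
    intro u
    induction u using List.reverseRecOn with
    | nil =>
      intro b _
      simpa using Finset.single_le_sum (f := fun a => S.wlen [a])
        (fun _ _ => diam_nonneg) (Finset.mem_univ b)
    | append_singleton u a ih =>
      intro b hw
      refine (h u a b hw).trans ?_
      have := mul_le_mul_of_nonneg_left (ih a (List.isChain_append.1 hw).1) (sub_nonneg.2 h1.le)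
      rw [List.length_append, List.length_singleton, pow_succ']
      linarith
  have hlim : Filter.Tendsto (fun n : ℕ => (1 - κ) ^ n * L) Filter.atTop (nhds 0) := by
    simpa using (tendsto_pow_atTop_nhds_zero_of_lt_one (sub_nonneg.2 h1.le)
      (by linarith)).mul_const L
  obtain ⟨N, hN⟩ := Filter.eventually_atTop.1 (hlim.eventually (gt_mem_nhds hτ))
  refine ⟨N + 1, by omega, fun w hw hlen => ?_⟩
  rcases List.eq_nil_or_concat w with rfl | ⟨u, b, rfl⟩
  · simp at hlen
  · rw [List.concat_eq_append] at hw hlen ⊢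
    rw [List.length_append, List.length_singleton] at hlen
    exact (key u b hw).trans (hN u.length (by omega)).le

lemma eq_of_prefix_of_mem_Ztau {τ : ℝ} {p q : List (Fin (2 * r))} (hp : p ∈ S.Ztau τ)
    (hq : q ∈ S.Ztau τ) (hpq : p <+: q) : p = q := by
  by_contra hne
  obtain ⟨s, rfl⟩ := hpq
  have hs : s ≠ [] := by rintro rfl; simp at hne
  have hpre : p <+: (p ++ s).dropLast := by
    rw [List.dropLast_append_of_ne_nil hs]
    exact List.prefix_append _ _
  rcases hq.2.2.2 with h | h
  · exact hp.1 (List.prefix_nil.1 (h ▸ hpre))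
  · have := S.wlen_le_of_prefix hp.1 hpre (List.IsChain.prefix hq.2.1 (List.dropLast_prefix _))
    linarith [hp.2.2.1]

end Schottky

/-- For every `τ > 0`, the set `Z(τ) = {a : |I_a| ≤ τ < |I_{a'}|}` is finite
and is a partition: every long enough word has exactly one prefix in `Z(τ)`. -/
theorem stmt3 {r : ℕ} (S : Schottky r) (τ : ℝ) (hτ : 0 < τ) :
    (S.Ztau τ).Finite ∧
    ∃ N : ℕ, ∀ w : List (Fin (2 * r)), IsWord w → N ≤ w.length →
      ∃! p : List (Fin (2 * r)), p ∈ S.Ztau τ ∧ p <+: w := by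
  obtain ⟨N, hN1, hN⟩ := S.exists_wlen_le_of_length_le hτ
  refine ⟨(List.finite_length_le _ N).subset ?_, N, fun w hw hlen => ?_⟩
  · rintro w ⟨-, hw, -, hd⟩
    by_contra hlen
    have hlen : N < w.length := not_le.1 hlen
    rcases hd with hd | hd
    · have := congrArg List.length hd
      simp at this
      omega
    · refine hd.not_ge (hN _ (List.IsChain.prefix hw (List.dropLast_prefix _)) ?_)
      simp
      omega
  · have hex : ∃ n, 1 ≤ n ∧ S.wlen (w.take n) ≤ τ :=
      ⟨w.length, hN1.trans hlen, by rw [List.take_length]; exact hN w hw hlen⟩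
    classical
    obtain ⟨h1, h2⟩ := Nat.find_spec hex
    have hle : Nat.find hex ≤ w.length :=
      Nat.find_min' hex ⟨hN1.trans hlen, by rw [List.take_length]; exact hN w hw hlen⟩
    have hmin : ∀ m, m < Nat.find hex → ¬ (1 ≤ m ∧ S.wlen (w.take m) ≤ τ) :=
      fun m hm => Nat.find_min hex hm
    generalize Nat.find hex = n at h1 h2 hle hmin
    have hmem : w.take n ∈ S.Ztau τ := by
      refine ⟨?_, List.IsChain.prefix hw (List.take_prefix _ _), h2, ?_⟩
      · rw [← List.length_pos_iff, List.length_take]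
        omega
      · have hdrop : (w.take n).dropLast = w.take (n - 1) := by
          rw [List.dropLast_eq_take, List.take_take, List.length_take]
          congr 1
          omega
        rw [hdrop]
        by_cases hn : n = 1
        · left
          simp [hn]
        · right
          by_contra! hcon
          exact hmin (n - 1) (by omega) ⟨by omega, hcon⟩
    refine ⟨w.take n, ⟨hmem, List.take_prefix _ _⟩, fun q hq => ?_⟩
    rcases List.prefix_or_prefix_of_prefix hq.2 (List.take_prefix n w) with h | h
    · exact S.eq_of_prefix_of_mem_Ztau hq.1 hmem h
    · exact (S.eq_of_prefix_of_mem_Ztau hmem hq.1 h).symm
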